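/- arXiv:2503.20575 — 2 statements merged into one kernel-verified Lean document; each statement's English description precedes it below -/
import Mathlib

section
/- Let K ≥ 2, a₁,…,a_K ∈ [A,B] ⊂ (0,1) with ∑_j a_j^d = 1 for some d ∈ [0,1], and let r ≥ d. Set p₁ = a₁^r. Then there exists r' ≤ d such that p₁ + ∑_{j=2}^K a_j^{r'} = 1; setting p_j = a_j^{r'} for j ≥ 2 yields probability weights (p_j ≥ 0, ∑_j p_j = 1) with p_j ≥ min{A, A^r} for all j, and max_j (log p_j / log a_j) = r. -/
open Real

/-- If `∑ aⱼ ^ d = 1`, raising the exponent of one term from `d` to `r` can be compensated by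
lowering the exponents of the others to a common `r' ∈ [0, d]`. -/
theorem exists_compensating_exponent {ι : Type*} [Fintype ι] [DecidableEq ι] [Nontrivial ι]
    {a : ι → ℝ} (ha0 : ∀ j, 0 < a j) (ha1 : ∀ j, a j ≤ 1) {d r : ℝ} (hd : 0 ≤ d) (hr : d ≤ r)
    (hda : ∑ j, a j ^ d = 1) (i : ι) :
    ∃ r' ∈ Set.Icc 0 d, ∑ j, (if j = i then a j ^ r else a j ^ r') = 1 := by
  have hcont : Continuous fun t : ℝ => ∑ j, (if j = i then a j ^ r else a j ^ t) := by
    refine continuous_finsetSum _ fun j _ => ?_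
    split_ifs
    · exact continuous_const
    · exact Real.continuous_const_rpow (ha0 j).ne'
  refine intermediate_value_Icc' hd hcont.continuousOn ⟨?_, ?_⟩
  · rw [← hda]
    refine Finset.sum_le_sum fun j _ => ?_
    split_ifs
    · exact Real.rpow_le_rpow_of_exponent_ge (ha0 j) (ha1 j) hr
    · exact le_rfl
  · obtain ⟨k, hk⟩ := exists_ne i
    have hle := Finset.single_le_sum
      (f := fun j => if j = i then a j ^ r else a j ^ (0 : ℝ))
      (fun j _ => by split_ifs <;> exact Real.rpow_nonneg (ha0 j).le _) (Finset.mem_univ k)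
    simpa only [if_neg hk, Real.rpow_zero] using hle

/-- The key construction in the dependent probabilities case: given contraction
ratios `aⱼ ∈ [A,B] ⊂ (0,1)` with similarity dimension `d ∈ [0,1]` and a target
`r ≥ d`, setting `p₁ = a₁^r` there is `r' ≤ d` so that `pⱼ = aⱼ^{r'}` (`j ≥ 2`)
completes a probability vector bounded below by `min A (A^r)` with
`maxⱼ log pⱼ / log aⱼ = r`. -/
theorem dependent_upper_attainable (K : ℕ) (hK : 2 ≤ K) (A B : ℝ)
    (hA : 0 < A) (hAB : A ≤ B) (hB : B < 1)
    (a : Fin K → ℝ) (ha : ∀ j, a j ∈ Set.Icc A B)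
    (d : ℝ) (hd : d ∈ Set.Icc (0:ℝ) 1) (hda : ∑ j, a j ^ d = 1)
    (r : ℝ) (hr : d ≤ r) :
    ∃ r' ≤ d, ∀ p : Fin K → ℝ,
      (p = fun j => if j = (⟨0, by omega⟩ : Fin K) then a j ^ r else a j ^ r') →
      (∀ j, 0 ≤ p j) ∧ (∑ j, p j = 1) ∧ (∀ j, min A (A ^ r) ≤ p j) ∧
      (∀ j, Real.log (p j) / Real.log (a j) ≤ r) ∧
      (∃ j, Real.log (p j) / Real.log (a j) = r) := by
  obtain ⟨hd0, hd1⟩ := hd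
  have ha0 : ∀ j, 0 < a j := fun j => hA.trans_le (ha j).1
  have ha1 : ∀ j, a j < 1 := fun j => (ha j).2.trans_lt hB
  have hlog : ∀ j (s : ℝ), Real.log (a j ^ s) / Real.log (a j) = s := fun j s => by
    rw [Real.log_rpow (ha0 j), mul_div_cancel_right₀ _ (Real.log_neg (ha0 j) (ha1 j)).ne]
  have : Nontrivial (Fin K) := Fin.nontrivial_iff_two_le.mpr hK
  obtain ⟨r', ⟨-, hr'd⟩, hsum⟩ :=
    exists_compensating_exponent ha0 (fun j => (ha1 j).le) hd0 hr hda ⟨0, by omega⟩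
  refine ⟨r', hr'd, ?_⟩
  rintro p rfl
  refine ⟨fun j => ?_, hsum, fun j => ?_, fun j => ?_, ⟨0, by omega⟩, ?_⟩
  · dsimp only
    split_ifs <;> exact Real.rpow_nonneg (ha0 j).le _
  · dsimp only
    split_ifs
    · exact (min_le_right _ _).trans (Real.rpow_le_rpow hA.le (ha j).1 (hd0.trans hr))
    · refine (min_le_left _ _).trans ((ha j).1.trans ?_)
      simpa only [Real.rpow_one] using
        Real.rpow_le_rpow_of_exponent_ge (ha0 j) (ha1 j).le (hr'd.trans hd1)
  · dsimp only
    split_ifs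
    · exact (hlog j r).le
    · exact (hlog j r').trans_le (hr'd.trans hr)
  · simpa only [if_true] using hlog _ r
end

section
/- Let K ≥ 2, a₁,…,a_K ∈ [A,B] ⊂ (0,1) with ∑_j a_j^d = 1 for some d > 0, and let 0 < r ≤ d. Set p₁ = a₁^r. Then there exists r' ≥ d such that p₁ + ∑_{j=2}^K a_j^{r'} = 1; setting p_j = a_j^{r'} for j ≥ 2 yields probability weights with min_j (log p_j / log a_j) = r. -/
open Real

open Filter Topology in
/-- Lowering the exponent at one index `i` of a family with similarity dimension `d` can be
compensated by raising the common exponent at all the other indices. -/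
theorem exists_exponent_sum_ite_rpow_eq_one {ι : Type*} [Fintype ι] [DecidableEq ι] (i : ι)
    {a : ι → ℝ} (ha0 : ∀ j, 0 < a j) (ha1 : ∀ j, a j < 1) {d r : ℝ}
    (hda : ∑ j, a j ^ d = 1) (hr0 : 0 < r) (hr : r ≤ d) :
    ∃ s, d ≤ s ∧ ∑ j, (if j = i then a j ^ r else a j ^ s) = 1 := by
  set g : ℝ → ℝ := fun s => ∑ j, (if j = i then a j ^ r else a j ^ s) with hg
  have hcont : Continuous g := by
    refine continuous_finsetSum _ fun j _ => ?_
    split_ifs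
    · exact continuous_const
    · exact Real.continuous_const_rpow (ha0 j).ne'
  have hgd : 1 ≤ g d := by
    rw [← hda]
    refine Finset.sum_le_sum fun j _ => ?_
    split_ifs
    · exact Real.rpow_le_rpow_of_exponent_ge (ha0 j) (ha1 j).le hr
    · exact le_rfl
  have hlim : Tendsto g atTop (𝓝 (∑ j, if j = i then a j ^ r else 0)) := by
    refine tendsto_finsetSum _ fun j _ => ?_
    split_ifs
    · exact tendsto_const_nhds
    · exact tendsto_rpow_atTop_of_base_lt_one (a j) (by linarith [ha0 j]) (ha1 j)
  have hlt : (∑ j, if j = i then a j ^ r else 0) < 1 := by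
    simpa using Real.rpow_lt_one (ha0 i).le (ha1 i) hr0
  obtain ⟨t, ht, hdt⟩ := ((hlim.eventually_lt_const hlt).and (eventually_ge_atTop d)).exists
  obtain ⟨s, hs, hs1⟩ := intermediate_value_Icc' hdt hcont.continuousOn ⟨ht.le, hgd⟩
  exact ⟨s, hs.1, hs1⟩

/-- The lower-dimension analogue of the dependent probabilities construction:
given contraction ratios with similarity dimension `d > 0` and a target
`0 < r ≤ d`, setting `p₁ = a₁^r` there is `r' ≥ d` so that `pⱼ = aⱼ^{r'}`
(`j ≥ 2`) completes a probability vector with `minⱼ log pⱼ / log aⱼ = r`. -/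
theorem dependent_lower_attainable (K : ℕ) (hK : 2 ≤ K) (A B : ℝ)
    (hA : 0 < A) (hAB : A ≤ B) (hB : B < 1)
    (a : Fin K → ℝ) (ha : ∀ j, a j ∈ Set.Icc A B)
    (d : ℝ) (hd : 0 < d) (hda : ∑ j, a j ^ d = 1)
    (r : ℝ) (hr0 : 0 < r) (hr : r ≤ d) :
    ∃ r', d ≤ r' ∧ ∀ p : Fin K → ℝ,
      (p = fun j => if j = (⟨0, by omega⟩ : Fin K) then a j ^ r else a j ^ r') →
      (∀ j, 0 ≤ p j) ∧ (∑ j, p j = 1) ∧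
      (∀ j, r ≤ Real.log (p j) / Real.log (a j)) ∧
      (∃ j, Real.log (p j) / Real.log (a j) = r) := by
  have ha0 : ∀ j, 0 < a j := fun j => hA.trans_le (ha j).1
  have ha1 : ∀ j, a j < 1 := fun j => (ha j).2.trans_lt hB
  have hlog : ∀ j s, Real.log (a j ^ s) / Real.log (a j) = s := fun j s => by
    rw [Real.log_rpow (ha0 j), mul_div_cancel_right₀ _ (Real.log_neg (ha0 j) (ha1 j)).ne]
  obtain ⟨s, hds, hs⟩ :=
    exists_exponent_sum_ite_rpow_eq_one (⟨0, by omega⟩ : Fin K) ha0 ha1 hda hr0 hr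
  refine ⟨s, hds, ?_⟩
  rintro p rfl
  refine ⟨fun j => ?_, hs, fun j => ?_, ⟨0, by omega⟩, ?_⟩
  · dsimp only
    split_ifs <;> exact Real.rpow_nonneg (ha0 j).le _
  · dsimp only
    split_ifs
    · exact (hlog j r).ge
    · exact (hr.trans hds).trans (hlog j s).ge
  · simpa only [if_true] using hlog _ r
end
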